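/- Let X and Y be real-valued random variables on a common probability space, each square-integrable with positive variance and with continuous distribution functions F(·;X) and F(·;Y). Let Z(X) = (X − E[X])/σ(X) and Z(Y) = (Y − E[Y])/σ(Y), and set a_j = E[Z(X)·Leg_j(F(X;X))], b_k = E[Z(Y)·Leg_k(F(Y;Y))], and LP(j,k;X,Y) = E[Leg_j(F(X;X))·Leg_k(F(Y;Y))] for j,k ≥ 1. Then the Pearson correlation satisfies R(X,Y) = E[Z(X)Z(Y)] = lim_{n→∞} ∑_{j=1}^{n} ∑_{k=1}^{n} a_j · LP(j,k;X,Y) · b_k. -/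

import Mathlib

open MeasureTheory Set Filter

/-- The `j`-th orthonormal shifted Legendre polynomial on `[0,1]` (Rodrigues'
formula), the result of Gram–Schmidt orthonormalization of `1, u, u², …` in
`L²([0,1])`. In particular `Leg 0 = 1` and `Leg 1 u = √12 (u − 1/2)`. -/
noncomputable def Leg (j : ℕ) (u : ℝ) : ℝ :=
  (Real.sqrt (2 * j + 1) / j.factorial) * iteratedDeriv j (fun x => (x ^ 2 - x) ^ j) u

/-- The distribution function `F(x;X) = P(X ≤ x)`. -/
noncomputable def distFun {Ω : Type*} [MeasurableSpace Ω] (P : Measure Ω)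
    (X : Ω → ℝ) (x : ℝ) : ℝ :=
  (P (X ⁻¹' Iic x)).toReal

/-- The standardization `Z(X) = (X − E[X])/σ(X)`. -/
noncomputable def stdize {Ω : Type*} [MeasurableSpace Ω] (P : Measure Ω)
    (X : Ω → ℝ) (ω : Ω) : ℝ :=
  (X ω - ∫ ω', X ω' ∂P) / Real.sqrt (ProbabilityTheory.variance X P)

/-- The LP comoment `LP(j,k;X,Y) = E[Leg_j(F(X;X))·Leg_k(F(Y;Y))]`. -/
noncomputable def LPcom {Ω : Type*} [MeasurableSpace Ω] (P : Measure Ω)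
    (X Y : Ω → ℝ) (j k : ℕ) : ℝ :=
  ∫ ω, Leg j (distFun P X (X ω)) * Leg k (distFun P Y (Y ω)) ∂P

section Legendre

open Polynomial

/-- The polynomial whose evaluation is the `j`-th orthonormal shifted Legendre function. -/
noncomputable def legPoly (j : ℕ) : ℝ[X] :=
  C (Real.sqrt (2 * j + 1) / j.factorial) * derivative^[j] ((X ^ 2 - X) ^ j)

theorem iteratedDeriv_polynomial_eval (p : ℝ[X]) (n : ℕ) :
    iteratedDeriv n (fun x => p.eval x) = fun x => (derivative^[n] p).eval x := by
  induction n generalizing p with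
  | zero => simp
  | succ n ih =>
    rw [iteratedDeriv_succ', Function.iterate_succ_apply, ← ih]
    congr 1
    ext x
    exact p.deriv

theorem Leg_eq_eval (j : ℕ) (u : ℝ) : Leg j u = (legPoly j).eval u := by
  have h := congrFun (iteratedDeriv_polynomial_eval ((X ^ 2 - X) ^ j) j) u
  simp only [eval_pow, eval_sub, eval_X] at h
  simp [Leg, legPoly, h]

theorem monic_X_sq_sub_X_pow (j : ℕ) : ((X ^ 2 - X : ℝ[X]) ^ j).Monic := by
  refine Monic.pow ?_ j
  monicity!

theorem natDegree_X_sq_sub_X_pow (j : ℕ) : ((X ^ 2 - X : ℝ[X]) ^ j).natDegree = 2 * j := by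
  have : (X ^ 2 - X : ℝ[X]).natDegree = 2 := by compute_degree!
  rw [natDegree_pow, this, mul_comm]

theorem natDegree_iterate_derivative_X_sq_sub_X_pow_le (j : ℕ) :
    (derivative^[j] ((X ^ 2 - X : ℝ[X]) ^ j)).natDegree ≤ j := by
  have h := natDegree_iterate_derivative ((X ^ 2 - X : ℝ[X]) ^ j) j
  rw [natDegree_X_sq_sub_X_pow] at h
  omega

theorem degree_legPoly (j : ℕ) : (legPoly j).degree = j := by
  have hc : Real.sqrt (2 * j + 1) / j.factorial ≠ 0 := by positivity
  rw [legPoly, degree_C_mul hc]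
  have hle := natDegree_iterate_derivative_X_sq_sub_X_pow_le j
  refine le_antisymm (natDegree_le_iff_degree_le.mp hle) (le_degree_of_ne_zero ?_)
  rw [coeff_iterate_derivative]
  have hl : ((X ^ 2 - X : ℝ[X]) ^ j).coeff (j + j) = 1 := by
    have := monic_X_sq_sub_X_pow j
    rwa [Monic, leadingCoeff, natDegree_X_sq_sub_X_pow, two_mul] at this
  rw [hl, nsmul_eq_mul, mul_one]
  exact_mod_cast (Nat.descFactorial_pos.mpr (Nat.le_add_left j j)).ne'

theorem iterate_derivative_two_mul_X_sq_sub_X_pow (j : ℕ) :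
    derivative^[j] (derivative^[j] ((X ^ 2 - X : ℝ[X]) ^ j)) = C ((2 * j).factorial : ℝ) := by
  rw [← Function.iterate_add_apply]
  have hd : (derivative^[j + j] ((X ^ 2 - X : ℝ[X]) ^ j)).natDegree = 0 := by
    have h := natDegree_iterate_derivative ((X ^ 2 - X : ℝ[X]) ^ j) (j + j)
    rw [natDegree_X_sq_sub_X_pow] at h
    omega
  have hl := monic_X_sq_sub_X_pow j
  rw [Monic, leadingCoeff, natDegree_X_sq_sub_X_pow, two_mul] at hl
  rw [eq_C_of_natDegree_eq_zero hd, coeff_iterate_derivative, zero_add, hl,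
    Nat.descFactorial_self, two_mul]
  simp

theorem eval_iterate_derivative_X_sq_sub_X_pow {i j : ℕ} (hij : i < j) {a : ℝ}
    (ha : a ^ 2 = a) : (derivative^[i] ((X ^ 2 - X : ℝ[X]) ^ j)).eval a = 0 := by
  have h1 : (X - C a) ^ j ∣ (X ^ 2 - X : ℝ[X]) ^ j :=
    pow_dvd_pow_of_dvd (dvd_iff_isRoot.mpr (by simp [ha])) j
  have h2 := pow_sub_dvd_iterate_derivative_of_pow_dvd i h1
  exact dvd_iff_isRoot.mp ((dvd_pow_self _ (by omega)).trans h2)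

theorem integral_eval_mul_iterate_derivative (q : ℝ[X]) (j : ℕ)
    (h0 : ∀ i < j, (derivative^[i] q).eval 0 = 0) (h1 : ∀ i < j, (derivative^[i] q).eval 1 = 0)
    (p : ℝ[X]) :
    ∫ x in (0 : ℝ)..1, p.eval x * (derivative^[j] q).eval x =
      (-1) ^ j * ∫ x in (0 : ℝ)..1, (derivative^[j] p).eval x * q.eval x := by
  induction j generalizing p with
  | zero => simp
  | succ j ih =>
    rw [Function.iterate_succ_apply' derivative j q,
      intervalIntegral.integral_mul_deriv_eq_deriv_mul
        (fun x _ => p.hasDerivAt x) (fun x _ => (derivative^[j] q).hasDerivAt x)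
        (derivative p).continuous.continuousOn.intervalIntegrable
        (derivative (derivative^[j] q)).continuous.continuousOn.intervalIntegrable,
      h0 j j.lt_succ_self, h1 j j.lt_succ_self,
      ih (fun i hi => h0 i (by omega)) (fun i hi => h1 i (by omega)),
      Function.iterate_succ_apply, pow_succ]
    ring

theorem integral_pow_mul_one_sub_pow (n m : ℕ) :
    (∫ x in (0 : ℝ)..1, x ^ m * (1 - x) ^ n) * (m + n + 1).factorial =
      m.factorial * n.factorial := by
  induction n generalizing m with
  | zero =>
    simp [Nat.factorial_succ]
    field_simp
  | succ n ih =>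
    have hu (x : ℝ) : HasDerivAt (fun x : ℝ => (1 - x) ^ (n + 1)) (-((n + 1) * (1 - x) ^ n)) x := by
      have := ((hasDerivAt_id x).const_sub 1).fun_pow (n + 1)
      simpa using this
    have hv (x : ℝ) : HasDerivAt (fun x : ℝ => x ^ (m + 1) / (m + 1)) (x ^ m) x := by
      have := (hasDerivAt_pow (m + 1) x).div_const ((m : ℝ) + 1)
      have hm : (m : ℝ) + 1 ≠ 0 := by positivity
      simpa [hm] using this
    have key := intervalIntegral.integral_mul_deriv_eq_deriv_mul (a := 0) (b := 1)
      (fun x _ => hu x) (fun x _ => hv x)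
      (Continuous.intervalIntegrable (by fun_prop) _ _)
      (Continuous.intervalIntegrable (by fun_prop) _ _)
    have hr : ∫ x in (0 : ℝ)..1, -((n + 1) * (1 - x) ^ n) * (x ^ (m + 1) / (m + 1)) =
        -((n + 1) / (m + 1)) * ∫ x in (0 : ℝ)..1, x ^ (m + 1) * (1 - x) ^ n := by
      rw [← intervalIntegral.integral_const_mul]
      congr 1
      ext x
      ring
    rw [hr] at key
    have ih' := ih (m + 1)
    simp_rw [mul_comm (_ ^ m)]
    rw [key, show m + (n + 1) + 1 = m + 1 + n + 1 by ring]
    rw [Nat.factorial_succ m] at ih'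
    rw [Nat.factorial_succ n]
    push_cast at ih' ⊢
    simp
    field_simp
    linear_combination ih'

theorem integral_X_sq_sub_X_pow (j : ℕ) :
    (∫ x in (0 : ℝ)..1, ((X ^ 2 - X : ℝ[X]) ^ j).eval x) * (2 * j + 1).factorial =
      (-1) ^ j * (j.factorial : ℝ) ^ 2 := by
  have h := integral_pow_mul_one_sub_pow j j
  have h2 : ∫ x in (0 : ℝ)..1, ((X ^ 2 - X : ℝ[X]) ^ j).eval x =
      (-1) ^ j * ∫ x in (0 : ℝ)..1, x ^ j * (1 - x) ^ j := by
    rw [← intervalIntegral.integral_const_mul]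
    congr 1
    ext x
    simp only [eval_pow, eval_sub, eval_X, ← mul_pow]
    ring
  rw [h2, mul_assoc, two_mul, h, sq]

theorem integral_legPoly_mul_of_le {i j : ℕ} (hij : i ≤ j) :
    ∫ x in (0 : ℝ)..1, (legPoly i).eval x * (legPoly j).eval x = if i = j then 1 else 0 := by
  set c : ℕ → ℝ := fun j => Real.sqrt (2 * j + 1) / j.factorial with hc
  have h1 : ∫ x in (0 : ℝ)..1, (legPoly i).eval x * (legPoly j).eval x =
      c i * c j * ∫ x in (0 : ℝ)..1, (derivative^[i] ((X ^ 2 - X) ^ i)).eval x *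
        (derivative^[j] ((X ^ 2 - X) ^ j)).eval x := by
    rw [← intervalIntegral.integral_const_mul]
    congr 1
    ext x
    simp only [legPoly, eval_mul, eval_C, hc]
    ring
  rw [h1, integral_eval_mul_iterate_derivative _ _
    (fun k hk => eval_iterate_derivative_X_sq_sub_X_pow hk (by simp))
    (fun k hk => eval_iterate_derivative_X_sq_sub_X_pow hk (by simp))]
  rcases hij.eq_or_lt with rfl | hlt
  · rw [iterate_derivative_two_mul_X_sq_sub_X_pow]
    have h2 := integral_X_sq_sub_X_pow i
    have h3 : c i * c i * (i.factorial : ℝ) ^ 2 = 2 * i + 1 := by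
      simp only [hc]
      field_simp
      exact Real.sq_sqrt (by positivity)
    have h4 : ((-1 : ℝ) ^ i) * (-1) ^ i = 1 := by rw [← mul_pow]; simp
    simp only [eval_C, intervalIntegral.integral_const_mul, if_true]
    rw [Nat.factorial_succ] at h2
    push_cast at h2
    have h5 : (2 * (i : ℝ) + 1) ≠ 0 := by positivity
    refine mul_left_cancel₀ h5 ?_
    linear_combination c i * c i * (-1) ^ i * h2 + c i * c i * (i.factorial : ℝ) ^ 2 * h4 + h3
  · have h6 : derivative^[j] (derivative^[i] ((X ^ 2 - X : ℝ[X]) ^ i)) = 0 :=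
      iterate_derivative_eq_zero
        ((natDegree_iterate_derivative_X_sq_sub_X_pow_le i).trans_lt hlt)
    simp [h6, hlt.ne]

theorem integral_legPoly_mul (i j : ℕ) :
    ∫ x in (0 : ℝ)..1, (legPoly i).eval x * (legPoly j).eval x = if i = j then 1 else 0 := by
  rcases le_total i j with h | h
  · exact integral_legPoly_mul_of_le h
  · simp_rw [mul_comm ((legPoly i).eval _), eq_comm (a := i)]
    exact integral_legPoly_mul_of_le h

/-- The orthonormal shifted Legendre polynomials as a degree-graded sequence. -/
noncomputable def legSequence : Polynomial.Sequence ℝ where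
  elems' := legPoly
  degree_eq' := degree_legPoly

theorem span_range_legPoly : Submodule.span ℝ (range legPoly) = ⊤ :=
  legSequence.span fun i => (leadingCoeff_ne_zero.mpr (legSequence.ne_zero i)).isUnit

end Legendre

section LegendreBasis

open scoped unitInterval

/-- The restriction of the `j`-th shifted Legendre polynomial to the unit interval. -/
noncomputable def legMap (j : ℕ) : C(I, ℝ) := (legPoly j).toContinuousMapOn I

theorem legMap_apply (j : ℕ) (u : I) : legMap j u = Leg j u := (Leg_eq_eval j u).symm

/-- The `j`-th shifted Legendre polynomial as an element of `L²([0,1])`. -/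
noncomputable def legLp (j : ℕ) : Lp ℝ 2 (volume : Measure I) :=
  ContinuousMap.toLp 2 volume ℝ (legMap j)

theorem orthonormal_legLp : Orthonormal ℝ legLp := by
  rw [orthonormal_iff_ite]
  intro i j
  rw [legLp, legLp, ContinuousMap.inner_toLp]
  have h := unitInterval.measurePreserving_coe.integral_comp
    unitInterval.measurableEmbedding_coe
    (fun x : ℝ => (legPoly i).eval x * (legPoly j).eval x)
  rw [integral_Icc_eq_integral_Ioc, ← intervalIntegral.integral_of_le zero_le_one,
    integral_legPoly_mul] at h
  rw [← h]
  refine integral_congr_ae (.of_forall fun x => ?_)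
  simp [legMap, mul_comm]

theorem span_range_legMap_closure_eq_top :
    (Submodule.span ℝ (range legMap)).topologicalClosure = ⊤ := by
  have h : Submodule.span ℝ (range legMap) = (polynomialFunctions I).toSubmodule := by
    have : legMap = (Polynomial.toContinuousMapOnAlgHom I).toLinearMap ∘ legPoly := rfl
    rw [this, range_comp, ← Submodule.map_span, span_range_legPoly]
    rfl
  rw [h]
  exact congrArg Subalgebra.toSubmodule polynomialFunctions_closure_eq_top'

theorem span_range_legLp_closure_eq_top :
    (Submodule.span ℝ (range legLp)).topologicalClosure = ⊤ := by
  have h := (ContinuousMap.toLp_denseRange ℝ (volume : Measure I) ℝ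
    (p := 2) (by simp)).topologicalClosure_map_submodule span_range_legMap_closure_eq_top
  rw [Submodule.map_span] at h
  rw [← h]
  congr 2
  exact range_comp _ legMap

/-- The shifted Legendre polynomials form a Hilbert basis of `L²([0,1])`. -/
noncomputable def legBasis : HilbertBasis ℕ ℝ (Lp ℝ 2 (volume : Measure I)) :=
  HilbertBasis.mk orthonormal_legLp span_range_legLp_closure_eq_top.ge

theorem legBasis_apply (j : ℕ) : legBasis j = legLp j :=
  congrFun (HilbertBasis.coe_mk _ _) j

end LegendreBasis

section ProbabilityTransform

open scoped unitInterval

variable {Ω : Type*} [MeasurableSpace Ω] {P : Measure Ω} [IsProbabilityMeasure P] {X : Ω → ℝ}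

theorem monotone_distFun : Monotone (distFun P X) := fun _ _ h =>
  measureReal_mono (preimage_mono (Iic_subset_Iic.mpr h))

theorem distFun_mem_unitInterval (x : ℝ) : distFun P X x ∈ I :=
  ⟨measureReal_nonneg, measureReal_le_one⟩

theorem distFun_eq_cdf (hX : Measurable X) : distFun P X = ProbabilityTheory.cdf (P.map X) := by
  have := Measure.isProbabilityMeasure_map (μ := P) hX.aemeasurable
  ext x
  rw [ProbabilityTheory.cdf_eq_real, map_measureReal_apply hX measurableSet_Iic]
  rfl

theorem exists_distFun_eq (hX : Measurable X) (hF : Continuous (distFun P X)) {t : ℝ}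
    (ht : t ∈ Ioo (0 : ℝ) 1) : ∃ x, distFun P X x = t := by
  have h0 : Tendsto (distFun P X) atBot (nhds 0) := by
    rw [distFun_eq_cdf hX]
    exact ProbabilityTheory.tendsto_cdf_atBot _
  have h1 : Tendsto (distFun P X) atTop (nhds 1) := by
    rw [distFun_eq_cdf hX]
    exact ProbabilityTheory.tendsto_cdf_atTop _
  obtain ⟨a, ha⟩ := (h0.eventually_lt_const ht.1).exists
  obtain ⟨b, hb⟩ := (h1.eventually_const_lt ht.2).exists
  exact mem_range_of_exists_le_of_exists_ge hF ⟨a, ha.le⟩ ⟨b, hb.le⟩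

theorem measureReal_distFun_le (hX : Measurable X) (hF : Continuous (distFun P X)) {t : ℝ}
    (ht : t ∈ I) : P.real {ω | distFun P X (X ω) ≤ t} = t := by
  refine le_antisymm ?_ ?_
  · rcases ht.2.eq_or_lt with rfl | ht1
    · exact measureReal_le_one
    · refine le_of_forall_gt_imp_ge_of_dense fun s hs => ?_
      rcases lt_or_ge s 1 with hs1 | hs1
      · obtain ⟨y, rfl⟩ := exists_distFun_eq hX hF ⟨ht.1.trans_lt hs, hs1⟩
        refine measureReal_mono fun ω hω => ?_
        exact (monotone_distFun.reflect_lt (lt_of_le_of_lt hω hs)).le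
      · exact measureReal_le_one.trans hs1
  · rcases ht.1.eq_or_lt with rfl | ht0
    · exact measureReal_nonneg
    rcases ht.2.eq_or_lt with rfl | ht1
    · have : {ω | distFun P X (X ω) ≤ 1} = univ :=
        eq_univ_of_forall fun ω => (distFun_mem_unitInterval (X ω)).2
      simp [this]
    · obtain ⟨x, rfl⟩ := exists_distFun_eq hX hF ⟨ht0, ht1⟩
      exact measureReal_mono fun ω hω => monotone_distFun hω

/-- The probability integral transform `F(X;X)`, valued in the unit interval. -/
noncomputable def probTransform (P : Measure Ω) [IsProbabilityMeasure P] (X : Ω → ℝ) (ω : Ω) : I :=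
  ⟨distFun P X (X ω), distFun_mem_unitInterval (X ω)⟩

theorem measurePreserving_probTransform (hX : Measurable X) (hF : Continuous (distFun P X)) :
    MeasurePreserving (probTransform P X) P volume := by
  have hm : Measurable (probTransform P X) := (hF.measurable.comp hX).subtype_mk
  refine ⟨hm, ?_⟩
  have := Measure.isProbabilityMeasure_map (μ := P) hm.aemeasurable
  refine Measure.ext_of_Iic _ _ fun a => ?_
  rw [Measure.map_apply hm measurableSet_Iic, unitInterval.volume_Iic,
    ← ofReal_measureReal]
  exact congrArg ENNReal.ofReal (measureReal_distFun_le hX hF a.2)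

/-- A random variable with continuous distribution function is almost surely a measurable
function of its probability integral transform. -/
theorem exists_measurable_ae_eq_comp_probTransform (hX : Measurable X)
    (hF : Continuous (distFun P X)) :
    ∃ g : I → ℝ, Measurable g ∧ X =ᵐ[P] g ∘ probTransform P X := by
  let G : I → EReal := fun u => ⨅ q : ℚ, if (u : ℝ) ≤ distFun P X q then ((q : ℝ) : EReal) else ⊤
  have hG : Measurable G := .iInf fun q =>
    Measurable.ite (measurableSet_le measurable_subtype_coe measurable_const)
      measurable_const measurable_const
  refine ⟨fun u => (G u).toReal, hG.ereal_toReal, ?_⟩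
  have hq (q : ℚ) : ∀ᵐ ω ∂P, distFun P X (X ω) ≤ distFun P X q → X ω ≤ q := by
    have hsub : X ⁻¹' Iic (q : ℝ) ⊆ {ω | distFun P X (X ω) ≤ distFun P X q} :=
      fun ω hω => monotone_distFun hω
    have h := ae_eq_of_subset_of_measure_ge hsub (μ := P) ?_
      (hX measurableSet_Iic).nullMeasurableSet (measure_ne_top _ _)
    · filter_upwards [h.mem_iff] with ω hω hle
      exact hω.mpr hle
    · rw [← ofReal_measureReal, measureReal_distFun_le hX hF (distFun_mem_unitInterval _)]
      exact ENNReal.ofReal_toReal_le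
  filter_upwards [ae_all_iff.mpr hq] with ω hω
  have : G (probTransform P X ω) = (X ω : EReal) := by
    refine le_antisymm ?_ (le_iInf fun q => ?_)
    · refine le_of_forall_gt fun c hc => ?_
      obtain ⟨q, hq1, hq2⟩ := EReal.lt_iff_exists_rat_btwn.mp hc
      refine (iInf_le _ q).trans_lt ?_
      rw [if_pos]
      · exact hq2
      · exact monotone_distFun (EReal.coe_lt_coe_iff.mp hq1).le
    · split_ifs with h
      · exact EReal.coe_le_coe_iff.mpr (hω q h)
      · exact le_top
  simp [this]

theorem memLp_Leg_distFun (hX : Measurable X) (hF : Continuous (distFun P X)) (j : ℕ) :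
    MemLp (fun ω => Leg j (distFun P X (X ω))) 2 P := by
  have h := ((Lp.memLp (legLp j)).ae_eq
    (ContinuousMap.coeFn_toLp (p := 2) (𝕜 := ℝ) volume (legMap j))).comp_measurePreserving
    (measurePreserving_probTransform hX hF)
  exact (memLp_congr_ae (.of_forall fun ω => legMap_apply j _)).mp h

theorem tendsto_sum_integral_smul_Leg (hX : Measurable X) (hF : Continuous (distFun P X))
    {h : ℝ → ℝ} (hh : Measurable h) (hhX : MemLp (h ∘ X) 2 P) :
    Tendsto (fun n => ∑ j ∈ Finset.range n,
      (∫ ω, h (X ω) * Leg j (distFun P X (X ω)) ∂P) • (memLp_Leg_distFun hX hF j).toLp)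
      atTop (nhds hhX.toLp) := by
  obtain ⟨g, hg, hXg⟩ := exists_measurable_ae_eq_comp_probTransform hX hF
  have hU := measurePreserving_probTransform hX hF
  have hfg : h ∘ X =ᵐ[P] (h ∘ g) ∘ probTransform P X := hXg.fun_comp h
  have hgL : MemLp (h ∘ g) 2 (volume : Measure I) := by
    rw [← hU.map_eq, memLp_map_measure_iff (hh.comp hg).aestronglyMeasurable hU.aemeasurable]
    exact (memLp_congr_ae hfg).mp hhX
  let φ := Lp.compMeasurePreservingₗᵢ (E := ℝ) (p := 2) ℝ (probTransform P X) hU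
  have hφ : φ hgL.toLp = hhX.toLp :=
    (MemLp.toLp_eq_toLp_iff (hgL.comp_measurePreserving hU) hhX).mpr hfg.symm
  have hφL (j : ℕ) : φ (legLp j) = (memLp_Leg_distFun hX hF j).toLp := by
    refine Lp.ext ?_
    filter_upwards [Lp.coeFn_compMeasurePreserving (legLp j) hU,
      hU.quasiMeasurePreserving.ae_eq_comp
        (ContinuousMap.coeFn_toLp (p := 2) (𝕜 := ℝ) volume (legMap j)),
      (memLp_Leg_distFun hX hF j).coeFn_toLp] with ω h1 h2 h3
    rw [h3]
    exact (h1.trans h2).trans (legMap_apply j _)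
  have hcoef (j : ℕ) : legBasis.repr hgL.toLp j =
      ∫ ω, h (X ω) * Leg j (distFun P X (X ω)) ∂P := by
    rw [legBasis.repr_apply_apply, legBasis_apply, ← φ.inner_map_map, hφ, hφL, L2.inner_def]
    refine integral_congr_ae ?_
    filter_upwards [hhX.coeFn_toLp, (memLp_Leg_distFun hX hF j).coeFn_toLp] with ω h1 h2
    rw [h1, h2]
    simp
  have hs := ((legBasis.hasSum_repr hgL.toLp).mapL φ.toContinuousLinearMap).tendsto_sum_nat
  have hφ' : φ.toContinuousLinearMap hgL.toLp = hhX.toLp := hφ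
  rw [hφ'] at hs
  refine hs.congr fun n => Finset.sum_congr rfl fun j _ => ?_
  rw [hcoef, legBasis_apply, map_smul]
  exact congrArg _ (hφL j)

end ProbabilityTransform

section Standardization

variable {Ω : Type*} [MeasurableSpace Ω] {P : Measure Ω} [IsProbabilityMeasure P] {X : Ω → ℝ}

theorem Leg_zero (u : ℝ) : Leg 0 u = 1 := by simp [Leg]

theorem memLp_stdize (hX2 : MemLp X 2 P) : MemLp (stdize P X) 2 P := by
  have h := (hX2.sub (memLp_const (∫ ω', X ω' ∂P))).mul_const
    (Real.sqrt (ProbabilityTheory.variance X P))⁻¹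
  simpa only [stdize, div_eq_mul_inv] using! h

theorem integral_stdize (hX2 : MemLp X 2 P) : ∫ ω, stdize P X ω ∂P = 0 := by
  have hX1 : Integrable X P := hX2.integrable one_le_two
  simp only [stdize]
  rw [integral_div, integral_sub hX1 (integrable_const _)]
  simp

/-- A standardized random variable with continuous distribution function is the `L²` limit of its
expansion in the shifted Legendre polynomials of its probability integral transform, the constant
term being absent. -/
theorem tendsto_sum_stdize_Leg (hX : Measurable X) (hX2 : MemLp X 2 P)
    (hF : Continuous (distFun P X)) :
    Tendsto (fun n => ∑ j ∈ Finset.Icc 1 n,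
      (∫ ω, stdize P X ω * Leg j (distFun P X (X ω)) ∂P) • (memLp_Leg_distFun hX hF j).toLp)
      atTop (nhds (memLp_stdize hX2).toLp) := by
  have h := (tendsto_sum_integral_smul_Leg hX hF
    (h := fun x => (x - ∫ ω', X ω' ∂P) / Real.sqrt (ProbabilityTheory.variance X P))
    (by fun_prop) (memLp_stdize hX2)).comp (tendsto_add_atTop_nat 1)
  refine h.congr fun n => ?_
  rw [Function.comp_apply, Finset.range_eq_Ico, Finset.sum_eq_sum_Ico_succ_bot n.succ_pos]
  have h0 : ∫ ω, stdize P X ω * Leg 0 (distFun P X (X ω)) ∂P = 0 := by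
    simpa only [Leg_zero, mul_one] using integral_stdize hX2
  refine (congrArg (· + _) ((congrArg (· • _) h0).trans (zero_smul ℝ _))).trans (zero_add _)

end Standardization

/-- (Correlation representation of LP comoments.) For square
integrable `X, Y` with positive variances and continuous distribution functions,
the Pearson correlation `R(X,Y) = E[Z(X)Z(Y)]` equals
`lim_{n→∞} ∑_{j=1}^n ∑_{k=1}^n a_j · LP(j,k;X,Y) · b_k`, where
`a_j = E[Z(X)·Leg_j(F(X;X))]` and `b_k = E[Z(Y)·Leg_k(F(Y;Y))]`. -/
theorem pearson_LP_representation {Ω : Type*} [MeasurableSpace Ω]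
    (P : Measure Ω) [IsProbabilityMeasure P] (X Y : Ω → ℝ)
    (hX : Measurable X) (hY : Measurable Y)
    (hX2 : MemLp X 2 P) (hY2 : MemLp Y 2 P)
    (hvX : 0 < ProbabilityTheory.variance X P)
    (hvY : 0 < ProbabilityTheory.variance Y P)
    (hFX : Continuous (distFun P X)) (hFY : Continuous (distFun P Y)) :
    Tendsto
      (fun n => ∑ j ∈ Finset.Icc 1 n, ∑ k ∈ Finset.Icc 1 n,
        (∫ ω, stdize P X ω * Leg j (distFun P X (X ω)) ∂P) *
          LPcom P X Y j k *
          (∫ ω, stdize P Y ω * Leg k (distFun P Y (Y ω)) ∂P))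
      atTop (nhds (∫ ω, stdize P X ω * stdize P Y ω ∂P)) := by

  have h := (tendsto_sum_stdize_Leg hX hX2 hFX).inner (𝕜 := ℝ)
    (tendsto_sum_stdize_Leg hY hY2 hFY)
  have inner_toLp {f g : Ω → ℝ} (hf : MemLp f 2 P) (hg : MemLp g 2 P) :
      inner ℝ hf.toLp hg.toLp = ∫ ω, f ω * g ω ∂P := by
    rw [L2.inner_def]
    refine integral_congr_ae ?_
    filter_upwards [hf.coeFn_toLp, hg.coeFn_toLp] with ω h1 h2
    rw [h1, h2, Real.inner_apply]
  rw [inner_toLp] at h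
  refine h.congr fun n => ?_
  rw [sum_inner]
  refine Finset.sum_congr rfl fun j _ => ?_
  rw [inner_sum]
  refine Finset.sum_congr rfl fun k _ => ?_
  rw [real_inner_smul_left, real_inner_smul_right, inner_toLp, LPcom]
  ring
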